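/- Let G' = (V, A') be a two-terminal directed acyclic graph with source s and sink t in which every vertex is reachable from s, let A* ⊆ A' be given with positive capacities ν on A', and let V₁, V₂ ⊆ V be vertex sets such that G' is the series composition G'[V₁] ∗ G'[V₂] of the induced subgraphs. Let ϱ^{G'}, ϱ^{G'[V₁]}, ϱ^{G'[V₂]} be the label functions of G', G'[V₁], G'[V₂] (each with respect to its own source, sink, induced resetting arcs and capacities), and let n, n₁, n₂ denote their respective numbers of breakpoints. Then n ≤ n₁ + n₂. -/

import Mathlib

noncomputable section

open Finset

variable {V : Type*}

/-- The function `ϱ^a` prescribing the behavior of labels along an arc. -/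
def arcRho [DecidableEq V] (Astar : Finset (V × V)) (nu : V × V → ℝ)
    (a : V × V) (lv xa : ℝ) : ℝ :=
  if a ∈ Astar then xa / nu a else max lv (xa / nu a)

/-- Total flow on arcs of `Aset` leaving `v`. -/
def outSum [DecidableEq V] (Aset : Finset (V × V)) (x : V × V → ℝ) (v : V) : ℝ :=
  ∑ a ∈ Aset.filter (fun a => a.1 = v), x a

/-- Total flow on arcs of `Aset` entering `v`. -/
def inSum [DecidableEq V] (Aset : Finset (V × V)) (x : V × V → ℝ) (v : V) : ℝ :=
  ∑ a ∈ Aset.filter (fun a => a.2 = v), x a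

/-- `(V, Aset, Astar)` is a shortest path graph with resetting with source `s`:
`Astar ⊆ Aset`, `(V, Aset)` is acyclic, and every vertex is reachable from `s`. -/
def IsSPGR [DecidableEq V] (Aset Astar : Finset (V × V)) (s : V) : Prop :=
  Astar ⊆ Aset ∧
  (∀ v : V, ¬ Relation.TransGen (fun u w => (u, w) ∈ Aset) v v) ∧
  (∀ v : V, Relation.ReflTransGen (fun u w => (u, w) ∈ Aset) s v)

/-- `x` is a static `s`-`t` flow of value `val` on the arcs `Aset`,
with conservation required at the vertices of `Vset`. -/
def IsFlowOn [DecidableEq V] (Vset : Finset V) (Aset : Finset (V × V)) (s t : V)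
    (x : V × V → ℝ) (val : ℝ) : Prop :=
  (∀ a ∈ Aset, 0 ≤ x a) ∧
  (∀ v ∈ Vset, v ≠ s → v ≠ t → outSum Aset x v = inSum Aset x v) ∧
  outSum Aset x s - inSum Aset x s = val

/-- `x` is a normalized thin `s`-`t` flow with resetting of value `val`
with corresponding labels `l`. -/
def IsNTFOn [DecidableEq V] (Vset : Finset V) (Aset Astar : Finset (V × V)) (nu : V × V → ℝ)
    (s t : V) (x : V × V → ℝ) (val : ℝ) (l : V → ℝ) : Prop :=
  IsFlowOn Vset Aset s t x val ∧
  (∀ v ∈ Vset, 0 ≤ l v) ∧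
  (∀ w ∈ Vset, w ≠ s →
    (∀ a ∈ Aset, a.2 = w → l w ≤ arcRho Astar nu a (l a.1) (x a)) ∧
    (∃ a ∈ Aset, a.2 = w ∧ l w = arcRho Astar nu a (l a.1) (x a))) ∧
  (∀ a ∈ Aset, 0 < x a → l a.2 = arcRho Astar nu a (l a.1) (x a))

/-- Normalized thin `s`-`t` flow with resetting on the whole vertex type. -/
def IsNTF [DecidableEq V] [Fintype V] (Aset Astar : Finset (V × V)) (nu : V × V → ℝ)
    (s t : V) (x : V × V → ℝ) (val : ℝ) (l : V → ℝ) : Prop :=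
  IsNTFOn Finset.univ Aset Astar nu s t x val l

/-- `f` is affine on each member of a partition of `ℝ≥0` into `m` intervals. -/
def AffinePieces {E : Type*} [AddCommGroup E] [Module ℝ E] (f : ℝ → E) (m : ℕ) : Prop :=
  ∃ P : Finset (Set ℝ), P.card = m ∧
    ⋃₀ (↑P : Set (Set ℝ)) = Set.Ici (0 : ℝ) ∧
    ((↑P : Set (Set ℝ)).Pairwise fun I J => I ∩ J = ∅) ∧
    (∀ I ∈ P, I.OrdConnected) ∧
    (∀ I ∈ P, ∃ c d : E, ∀ q ∈ I, f q = q • c + d)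

/-- The number of breakpoints of a piecewise linear function on `ℝ≥0`:
the minimal `n` such that `ℝ≥0` can be partitioned into `n + 1` intervals
on each of which `f` is affine. -/
def breakpoints {E : Type*} [AddCommGroup E] [Module ℝ E] (f : ℝ → E) : ℕ :=
  sInf {n : ℕ | AffinePieces f (n + 1)}

/-- `(Vset, Aset)` is a two-terminal directed acyclic graph with (unique)
source `s` and (unique) sink `t`. -/
def TwoTerminal [DecidableEq V] (Vset : Finset V) (Aset : Finset (V × V)) (s t : V) : Prop :=
  s ∈ Vset ∧ t ∈ Vset ∧
  (∀ a ∈ Aset, a.1 ∈ Vset ∧ a.2 ∈ Vset) ∧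
  (∀ v : V, ¬ Relation.TransGen (fun u w => (u, w) ∈ Aset) v v) ∧
  (∀ v ∈ Vset, ((∀ a ∈ Aset, a.2 ≠ v) ↔ v = s)) ∧
  (∀ v ∈ Vset, ((∀ a ∈ Aset, a.1 ≠ v) ↔ v = t))

section ArcRho

variable [DecidableEq V] {Astar : Finset (V × V)} {nu : V × V → ℝ} {a : V × V}

lemma arcRho_mono (hnu : 0 < nu a) {l l' x x' : ℝ} (hl : l ≤ l') (hx : x ≤ x') :
    arcRho Astar nu a l x ≤ arcRho Astar nu a l' x' := by
  unfold arcRho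
  have h : x / nu a ≤ x' / nu a := div_le_div_of_nonneg_right hx hnu.le
  split_ifs
  · exact h
  · exact max_le_max hl h

lemma lt_of_arcRho_lt (hnu : 0 < nu a) {l l' x x' : ℝ} (hl : l' ≤ l)
    (h : arcRho Astar nu a l x < arcRho Astar nu a l' x') : x < x' := by
  by_contra! hx
  exact absurd (arcRho_mono hnu hl hx) (not_le.mpr h)

lemma le_of_arcRho_le (hnu : 0 < nu a) {l l' x x' : ℝ} (hl : l < l')
    (h : arcRho Astar nu a l' x' ≤ arcRho Astar nu a l x) : x' ≤ x := by
  unfold arcRho at h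
  split_ifs at h
  · exact (div_le_div_iff_of_pos_right hnu).mp h
  · have h₁ : l' ≤ max l (x / nu a) := (le_max_left _ _).trans h
    have h₂ : x' / nu a ≤ max l (x / nu a) := (le_max_right _ _).trans h
    rcases le_max_iff.mp h₁ with h₃ | h₃
    · exact absurd h₃ (not_le.mpr hl)
    · rw [max_eq_right (hl.le.trans h₃)] at h₂
      exact (div_le_div_iff_of_pos_right hnu).mp h₂

lemma div_le_arcRho (l x : ℝ) : x / nu a ≤ arcRho Astar nu a l x := by
  unfold arcRho
  split_ifs
  · exact le_rfl
  · exact le_max_right _ _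

lemma arcRho_smul {c : ℝ} (hc : 0 ≤ c) (l x : ℝ) :
    arcRho Astar nu a (c * l) (c * x) = c * arcRho Astar nu a l x := by
  unfold arcRho
  split_ifs
  · exact mul_div_assoc _ _ _
  · rw [mul_div_assoc, mul_max_of_nonneg _ _ hc]

lemma arcRho_inter {A : Finset (V × V)} (ha : a ∈ A) (l x : ℝ) :
    arcRho (Astar ∩ A) nu a l x = arcRho Astar nu a l x := by
  simp [arcRho, ha]

end ArcRho

section Flow

variable [DecidableEq V]

lemma sum_inSum_sub_outSum (S : Finset V) (A : Finset (V × V)) (x : V × V → ℝ) :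
    ∑ v ∈ S, (inSum A x v - outSum A x v) =
      ∑ a ∈ A, x a * ((if a.2 ∈ S then 1 else 0) - (if a.1 ∈ S then 1 else 0)) := by
  simp only [inSum, outSum, Finset.sum_filter, Finset.sum_sub_distrib, mul_sub]
  congr 1
  · rw [Finset.sum_comm]
    refine Finset.sum_congr rfl fun a _ => ?_
    simp
  · rw [Finset.sum_comm]
    refine Finset.sum_congr rfl fun a _ => ?_
    simp

lemma inSum_sub_outSum_sink {W : Finset V} {A : Finset (V × V)} {s t : V} {x : V × V → ℝ}
    {q : ℝ} (h : TwoTerminal W A s t) (hst : s ≠ t) (hx : IsFlowOn W A s t x q) :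
    inSum A x t - outSum A x t = q := by
  obtain ⟨hs, ht, hA, -, -, -⟩ := h
  obtain ⟨-, hcons, hval⟩ := hx
  have htot := sum_inSum_sub_outSum W A x
  rw [Finset.sum_eq_zero (s := A)] at htot
  · rw [← Finset.add_sum_erase _ _ hs,
      ← Finset.add_sum_erase _ _ (Finset.mem_erase.mpr ⟨hst.symm, ht⟩),
      Finset.sum_eq_zero (s := (W.erase s).erase t)] at htot
    · linarith
    · intro v hv
      simp only [Finset.mem_erase] at hv
      rw [hcons v hv.2.2 hv.2.1 hv.1, sub_self]
  · intro a ha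
    simp [hA a ha]

lemma source_ne_sink {W : Finset V} {A : Finset (V × V)} {s t : V} {x : V × V → ℝ}
    {q : ℝ} (h : TwoTerminal W A s t) (hx : IsFlowOn W A s t x q) (hq : q ≠ 0) : s ≠ t := by
  rintro rfl
  obtain ⟨hs, -, -, -, hin, hout⟩ := h
  apply hq
  rw [← hx.2.2, outSum, inSum, Finset.filter_false_of_mem ((hin s hs).mpr rfl),
    Finset.filter_false_of_mem ((hout s hs).mpr rfl)]
  simp

end Flow

section ThinFlow

variable [DecidableEq V] {W : Finset V} {A Astar : Finset (V × V)} {nu : V × V → ℝ} {s t : V}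

/-- Labels of thin flows are monotone in the source label and in the flow value. -/
lemma IsNTFOn.label_le [Finite V] (hnu : ∀ a ∈ A, 0 < nu a) (h : TwoTerminal W A s t)
    (hst : s ≠ t) {x x' : V × V → ℝ} {q q' : ℝ} {l l' : V → ℝ}
    (hx : IsNTFOn W A Astar nu s t x q l) (hx' : IsNTFOn W A Astar nu s t x' q' l')
    (hq : q' ≤ q) (hl : l' s ≤ l s) : ∀ v ∈ W, l' v ≤ l v := by
  have hsink := inSum_sub_outSum_sink h hst hx.1
  have hsink' := inSum_sub_outSum_sink h hst hx'.1
  obtain ⟨hsW, -, hA, hacyc, hin, -⟩ := h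
  obtain ⟨⟨hpos, hcons, -⟩, -, hlab, hact⟩ := hx
  obtain ⟨⟨hpos', hcons', -⟩, -, hlab', hact'⟩ := hx'
  set S := W.filter fun v => l v < l' v with hS
  have mem_S : ∀ v ∈ W, (v ∈ S ↔ l v < l' v) := fun v hv => by simp [hS, hv]
  have ne_s : ∀ v ∈ S, v ≠ s := by
    rintro v hv rfl
    exact absurd (Finset.mem_filter.mp hv).2 (not_lt.mpr hl)
  have hterm : ∀ a ∈ A, 0 ≤ (x' a - x a) *
      ((if a.2 ∈ S then 1 else 0) - (if a.1 ∈ S then 1 else 0)) := by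
    intro a ha
    by_cases h2 : a.2 ∈ S <;> by_cases h1 : a.1 ∈ S
    · simp [h1, h2]
    · have h1' := not_lt.mp fun hh => h1 ((mem_S _ (hA a ha).1).mpr hh)
      have h2' := (mem_S _ (hA a ha).2).mp h2
      have : x a ≤ x' a := by
        rcases (hpos a ha).eq_or_lt with h0 | h0
        · rw [← h0]; exact hpos' a ha
        · refine (lt_of_arcRho_lt (Astar := Astar) (hnu a ha) h1' ?_).le
          rw [← hact a ha h0]
          exact h2'.trans_le ((hlab' _ (hA a ha).2 (ne_s _ h2)).1 a ha rfl)
      simpa [h1, h2] using this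
    · have h1' := (mem_S _ (hA a ha).1).mp h1
      have h2' := not_lt.mp fun hh => h2 ((mem_S _ (hA a ha).2).mpr hh)
      have : x' a ≤ x a := by
        rcases (hpos' a ha).eq_or_lt with h0 | h0
        · rw [← h0]; exact hpos a ha
        · refine le_of_arcRho_le (Astar := Astar) (hnu a ha) h1' ?_
          rw [← hact' a ha h0]
          exact h2'.trans ((hlab _ (hA a ha).2 ((hin s hsW).mpr rfl a ha)).1 a ha rfl)
      simpa [h1, h2] using this
    · simp [h1, h2]
  have hsum : ∑ a ∈ A, (x' a - x a) *
      ((if a.2 ∈ S then 1 else 0) - (if a.1 ∈ S then 1 else 0)) ≤ 0 := by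
    simp only [sub_mul (x' _), Finset.sum_sub_distrib]
    rw [← sum_inSum_sub_outSum, ← sum_inSum_sub_outSum, ← Finset.sum_sub_distrib]
    refine Finset.sum_nonpos fun v hv => ?_
    by_cases hvt : v = t
    · subst hvt; linarith
    · have hvW := (Finset.mem_filter.mp hv).1
      rw [hcons v hvW (ne_s v hv) hvt, hcons' v hvW (ne_s v hv) hvt]
      simp
  have hzero := (Finset.sum_eq_zero_iff_of_nonneg hterm).mp
    (le_antisymm hsum (Finset.sum_nonneg hterm))
  by_contra! hne
  obtain ⟨u, huW, hu⟩ := hne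
  have hwf : WellFounded (Relation.TransGen fun u w => (u, w) ∈ A) :=
    haveI : Std.Irrefl (Relation.TransGen fun u w => (u, w) ∈ A) := ⟨hacyc⟩
    Finite.wellFounded_of_trans_of_irrefl _
  obtain ⟨w, hw, hmin⟩ := hwf.has_min {v | v ∈ S} ⟨u, (mem_S u huW).mpr hu⟩
  have hwW := (Finset.mem_filter.mp hw).1
  obtain ⟨a, ha, rfl, hla⟩ := (hlab w hwW (ne_s w hw)).2
  have h1 : a.1 ∉ S := fun h1 => hmin _ h1 (Relation.TransGen.single ha)
  have hw' : a.2 ∈ S := hw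
  have hxa : x' a = x a := by
    simpa [h1, hw', sub_eq_zero] using hzero a ha
  have hle := (hlab' _ hwW (ne_s _ hw)).1 a ha rfl
  rw [hxa] at hle
  have h1' := not_lt.mp fun hh => h1 ((mem_S _ (hA a ha).1).mpr hh)
  have := arcRho_mono (Astar := Astar) (hnu a ha) h1' (le_refl (x a))
  linarith [(mem_S _ hwW).mp hw]

lemma IsNTFOn.smul {x : V × V → ℝ} {q : ℝ} {l : V → ℝ} (h : IsNTFOn W A Astar nu s t x q l)
    {c : ℝ} (hc : 0 ≤ c) :
    IsNTFOn W A Astar nu s t (fun a => c * x a) (c * q) (fun v => c * l v) := by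
  obtain ⟨⟨hpos, hcons, hval⟩, hl, hlab, hact⟩ := h
  refine ⟨⟨fun a ha => mul_nonneg hc (hpos a ha), fun v hv hs ht => ?_, ?_⟩,
    fun v hv => mul_nonneg hc (hl v hv), fun w hw hs => ⟨fun a ha haw => ?_, ?_⟩,
    fun a ha hxa => ?_⟩
  · have := hcons v hv hs ht
    simp only [outSum, inSum, ← Finset.mul_sum] at this ⊢
    rw [this]
  · rw [← hval]
    simp only [outSum, inSum, ← Finset.mul_sum, mul_sub]
  · rw [arcRho_smul hc]
    exact mul_le_mul_of_nonneg_left ((hlab w hw hs).1 a ha haw) hc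
  · obtain ⟨a, ha, haw, hla⟩ := (hlab w hw hs).2
    exact ⟨a, ha, haw, by simp only [arcRho_smul hc, hla]⟩
  · simp only [arcRho_smul hc, hact a ha (pos_of_mul_pos_right hxa hc)]

lemma IsNTFOn.label_sink_pos (hnu : ∀ a ∈ A, 0 < nu a) (h : TwoTerminal W A s t)
    {x : V × V → ℝ} {q : ℝ} {l : V → ℝ} (hx : IsNTFOn W A Astar nu s t x q l)
    (hq : 0 < q) : 0 < l t := by
  have hsink := inSum_sub_outSum_sink h (source_ne_sink h hx.1 hq.ne') hx.1
  have hout : 0 ≤ outSum A x t :=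
    Finset.sum_nonneg fun a ha => hx.1.1 a (Finset.mem_filter.mp ha).1
  have hin : 0 < inSum A x t := by linarith
  obtain ⟨a, ha, hxa⟩ := Finset.exists_lt_of_sum_lt
    (s := A.filter fun a => a.2 = t) (f := fun _ => (0 : ℝ)) (g := x) (by rw [Finset.sum_const_zero]; exact hin)
  obtain ⟨haA, rfl⟩ := Finset.mem_filter.mp ha
  rw [hx.2.2.2 a haA hxa]
  exact (div_pos hxa (hnu a haA)).trans_le (div_le_arcRho _ _)

/-- A thin flow restricts to a subgraph with the same arcs around inner vertices. -/
lemma IsNTFOn.restrict {W' : Finset V} {A' : Finset (V × V)} {s' t' : V}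
    {x : V × V → ℝ} {q q' : ℝ} {l : V → ℝ} (h : IsNTFOn W A Astar nu s t x q l)
    (hW : W' ⊆ W) (hA : A' ⊆ A)
    (hin : ∀ a ∈ A, a.2 ∈ W' → a.2 ≠ s' → a ∈ A')
    (hout : ∀ a ∈ A, a.1 ∈ W' → a.1 ≠ t' → a ∈ A')
    (hs : ∀ v ∈ W', v ≠ s' → v ≠ s) (ht : ∀ v ∈ W', v ≠ t' → v ≠ t)
    (hval : outSum A' x s' - inSum A' x s' = q') :
    IsNTFOn W' A' (Astar ∩ A') nu s' t' x q' l := by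
  obtain ⟨⟨hpos, hcons, -⟩, hl, hlab, hact⟩ := h
  refine ⟨⟨fun a ha => hpos a (hA ha), fun v hv hvs hvt => ?_, hval⟩,
    fun v hv => hl v (hW hv), fun w hw hws => ⟨fun a ha haw => ?_, ?_⟩,
    fun a ha hxa => ?_⟩
  · have hc := hcons v (hW hv) (hs v hv hvs) (ht v hv hvt)
    have h1 : A'.filter (fun a => a.1 = v) = A.filter (fun a => a.1 = v) := by
      ext a
      simp only [Finset.mem_filter]
      exact ⟨fun ha => ⟨hA ha.1, ha.2⟩,
        fun ha => ⟨hout a ha.1 (ha.2 ▸ hv) (ha.2 ▸ hvt), ha.2⟩⟩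
    have h2 : A'.filter (fun a => a.2 = v) = A.filter (fun a => a.2 = v) := by
      ext a
      simp only [Finset.mem_filter]
      exact ⟨fun ha => ⟨hA ha.1, ha.2⟩,
        fun ha => ⟨hin a ha.1 (ha.2 ▸ hv) (ha.2 ▸ hvs), ha.2⟩⟩
    simp only [outSum, inSum] at hc ⊢
    rw [h1, h2, hc]
  · rw [arcRho_inter ha]
    exact (hlab w (hW hw) (hs w hw hws)).1 a (hA ha) haw
  · obtain ⟨a, ha, haw, hla⟩ := (hlab w (hW hw) (hs w hw hws)).2
    have ha' := hin a ha (haw ▸ hw) (haw ▸ hws)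
    exact ⟨a, ha', haw, by rw [arcRho_inter ha', hla]⟩
  · rw [arcRho_inter ha]
    exact hact a (hA ha) hxa

end ThinFlow

section Breakpoints

/-- Two maps with order-connected fibres on a linear order with bottom jointly take at most
`#A + #B - 1` values. -/
lemma exists_card_pairs_lt {X α β : Type*} [LinearOrder X] [OrderBot X]
    (A : Finset α) (B : Finset β) (i : X → α) (j : X → β)
    (hiA : ∀ x, i x ∈ A) (hjB : ∀ x, j x ∈ B)
    (hi : ∀ x y z, x ≤ y → y ≤ z → i x = i z → i y = i x)
    (hj : ∀ x y z, x ≤ y → y ≤ z → j x = j z → j y = j x) :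
    ∃ T : Finset (α × β), (∀ p, p ∈ T ↔ ∃ x, i x = p.1 ∧ j x = p.2) ∧
      T.card < A.card + B.card := by
  classical
  let T := (A ×ˢ B).filter fun p => ∃ x, i x = p.1 ∧ j x = p.2
  have hT : ∀ p, p ∈ T ↔ ∃ x, i x = p.1 ∧ j x = p.2 := by
    rintro ⟨a, b⟩
    simp only [T, Finset.mem_filter, Finset.mem_product, and_iff_right_iff_imp]
    rintro ⟨x, rfl, rfl⟩
    exact ⟨hiA x, hjB x⟩
  refine ⟨T, hT, ?_⟩
  let F := T.filter fun p => ∀ x y, i x = p.1 → j x = p.2 → i y = p.1 → j y ≠ p.2 → x < y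
  let G := T.filter fun p => ∀ x y, i x = p.1 → j x = p.2 → j y = p.2 → i y ≠ p.1 → x < y
  have hF : F.card ≤ A.card := by
    refine Finset.card_le_card_of_injOn Prod.fst
      (fun p hp => (Finset.mem_product.mp (Finset.mem_filter.mp (Finset.mem_filter.mp hp).1).1).1)
      ?_
    rintro ⟨a, b⟩ hp ⟨a', b'⟩ hp' (rfl : a = a')
    obtain ⟨hpT, hp⟩ := Finset.mem_filter.mp hp
    obtain ⟨hpT', hp'⟩ := Finset.mem_filter.mp hp'
    obtain ⟨x, hx, hx'⟩ := (hT _).mp hpT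
    obtain ⟨y, hy, hy'⟩ := (hT _).mp hpT'
    by_contra hne
    have hbb : b ≠ b' := fun h => hne (by rw [h])
    exact lt_asymm (hp x y hx hx' hy (fun h => hbb (h.symm.trans hy')))
      (hp' y x hy hy' hx (fun h => hbb (hx'.symm.trans h)))
  have hG : G.card ≤ B.card := by
    refine Finset.card_le_card_of_injOn Prod.snd
      (fun p hp => (Finset.mem_product.mp (Finset.mem_filter.mp (Finset.mem_filter.mp hp).1).1).2)
      ?_
    rintro ⟨a, b⟩ hp ⟨a', b'⟩ hp' (rfl : b = b')
    obtain ⟨hpT, hp⟩ := Finset.mem_filter.mp hp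
    obtain ⟨hpT', hp'⟩ := Finset.mem_filter.mp hp'
    obtain ⟨x, hx, hx'⟩ := (hT _).mp hpT
    obtain ⟨y, hy, hy'⟩ := (hT _).mp hpT'
    by_contra hne
    have haa : a ≠ a' := fun h => hne (by rw [h])
    exact lt_asymm (hp x y hx hx' hy' (fun h => haa (h.symm.trans hy)))
      (hp' y x hy hy' hx' (fun h => haa (hx.symm.trans h)))
  have hcover : T ⊆ F ∪ G := by
    intro p hp
    by_contra hn
    simp only [F, G, Finset.mem_union, Finset.mem_filter, hp, true_and, not_or] at hn
    push Not at hn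
    obtain ⟨⟨x, y, hx, hx', hy, hy', hyx⟩, u, v, hu, hu', hv, hv', hvu⟩ := hn
    rcases le_total y v with h | h
    · exact hv' ((hi y v u h hvu (hy.trans hu.symm)).trans hy)
    · exact hy' ((hj v y x h hyx (hv.trans hx'.symm)).trans hv)
  have hbot : (i ⊥, j ⊥) ∈ F ∩ G := by
    have hmem : (i ⊥, j ⊥) ∈ T := (hT _).mpr ⟨⊥, rfl, rfl⟩
    simp only [F, G, Finset.mem_inter, Finset.mem_filter, hmem, true_and]
    constructor
    · intro x y _ hx' _ hy
      by_contra! hyx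
      exact hy (hj ⊥ y x bot_le hyx hx'.symm)
    · intro x y hx _ _ hy
      by_contra! hyx
      exact hy (hi ⊥ y x bot_le hyx hx.symm)
  have h1 := Finset.card_le_card hcover
  have h2 := Finset.card_union_add_card_inter F G
  have h3 := Finset.card_pos.mpr ⟨_, hbot⟩
  omega

lemma affinePieces_breakpoints {E : Type*} [AddCommGroup E] [Module ℝ E] {f : ℝ → E}
    (h : ∃ m : ℕ, AffinePieces f m) : AffinePieces f (breakpoints f + 1) := by
  obtain ⟨m, hm⟩ := h
  refine Nat.sInf_mem (s := {n : ℕ | AffinePieces f (n + 1)}) ?_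
  obtain ⟨P, hcard, hU, -⟩ := id hm
  cases m with
  | zero =>
    rw [Finset.card_eq_zero.mp hcard] at hU
    have : (0 : ℝ) ∈ Set.Ici (0 : ℝ) := Set.mem_Ici.mpr le_rfl
    rw [← hU] at this
    simp at this
  | succ n => exact ⟨n, hm⟩

/-- If `f` is affine wherever `f₁` is affine at `q` and `f₂` is affine at `g q`, for a monotone
reparametrization `g`, then the breakpoints of `f` are bounded by those of `f₁` and `f₂`. -/
lemma breakpoints_le_add {E E₁ E₂ : Type*} [AddCommGroup E] [Module ℝ E]
    [AddCommGroup E₁] [Module ℝ E₁] [AddCommGroup E₂] [Module ℝ E₂]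
    {f : ℝ → E} {f₁ : ℝ → E₁} {f₂ : ℝ → E₂} (g : ℝ → ℝ)
    (h₁ : ∃ m : ℕ, AffinePieces f₁ m) (h₂ : ∃ m : ℕ, AffinePieces f₂ m)
    (hg₀ : ∀ q, 0 ≤ q → 0 ≤ g q) (hg : MonotoneOn g (Set.Ici 0))
    (hf : ∀ (c₁ d₁ : E₁) (c₂ d₂ : E₂), ∃ c d : E, ∀ q, 0 ≤ q → f₁ q = q • c₁ + d₁ →
      f₂ (g q) = g q • c₂ + d₂ → f q = q • c + d) :
    breakpoints f ≤ breakpoints f₁ + breakpoints f₂ := by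
  classical
  obtain ⟨P, hPc, hPU, hPd, hPo, hPa⟩ := affinePieces_breakpoints h₁
  obtain ⟨Q, hQc, hQU, hQd, hQo, hQa⟩ := affinePieces_breakpoints h₂
  have hex : ∀ x : NNReal, ∃ I ∈ P, (x : ℝ) ∈ I := fun x => by
    have : (x : ℝ) ∈ Set.Ici (0 : ℝ) := x.2
    rw [← hPU] at this
    simpa using this
  have hex' : ∀ x : NNReal, ∃ J ∈ Q, g x ∈ J := fun x => by
    have : g x ∈ Set.Ici (0 : ℝ) := hg₀ _ x.2
    rw [← hQU] at this
    simpa using this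
  choose i hiP hi using hex
  choose j hjQ hj using hex'
  have hiu : ∀ (x : NNReal), ∀ I ∈ P, (x : ℝ) ∈ I → i x = I := fun x I hI hx => by
    by_contra hne
    have : i x ∩ I = ∅ := hPd (hiP x) hI hne
    exact Set.eq_empty_iff_forall_notMem.mp this x ⟨hi x, hx⟩
  have hju : ∀ (x : NNReal), ∀ J ∈ Q, g x ∈ J → j x = J := fun x J hJ hx => by
    by_contra hne
    have : j x ∩ J = ∅ := hQd (hjQ x) hJ hne
    exact Set.eq_empty_iff_forall_notMem.mp this (g x) ⟨hj x, hx⟩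
  obtain ⟨T, hT, hTc⟩ := exists_card_pairs_lt P Q i j hiP hjQ
    (fun x y z hxy hyz h => hiu y _ (hiP x)
      ((hPo _ (hiP x)).out (hi x) (h ▸ hi z) ⟨hxy, hyz⟩))
    (fun x y z hxy hyz h => hju y _ (hjQ x)
      ((hQo _ (hjQ x)).out (hj x) (h ▸ hj z) ⟨hg x.2 y.2 hxy, hg y.2 z.2 hyz⟩))
  let piece : Set ℝ × Set ℝ → Set ℝ := fun p => {q | 0 ≤ q ∧ q ∈ p.1 ∧ g q ∈ p.2}
  have hTP : ∀ p ∈ T, p.1 ∈ P ∧ p.2 ∈ Q := fun p hp => by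
    obtain ⟨x, hx, hx'⟩ := (hT p).mp hp
    exact ⟨hx ▸ hiP x, hx' ▸ hjQ x⟩
  have hpos : 0 < (T.image piece).card := by
    refine Finset.card_pos.mpr ⟨piece (i 0, j 0), Finset.mem_image_of_mem _ ?_⟩
    exact (hT _).mpr ⟨0, rfl, rfl⟩
  have hle := Finset.card_image_le (s := T) (f := piece)
  suffices hm : AffinePieces f ((T.image piece).card - 1 + 1) by
    have : breakpoints f ≤ (T.image piece).card - 1 := Nat.sInf_le hm
    omega
  refine ⟨T.image piece, by omega, ?_, ?_, ?_, ?_⟩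
  · ext q
    simp only [Finset.coe_image, Set.sUnion_image, Finset.mem_coe, Set.mem_iUnion, Set.mem_Ici]
    constructor
    · rintro ⟨p, -, hq⟩
      exact hq.1
    · intro hq
      exact ⟨(i ⟨q, hq⟩, j ⟨q, hq⟩), (hT _).mpr ⟨_, rfl, rfl⟩, hq, hi ⟨q, hq⟩, hj ⟨q, hq⟩⟩
  · intro I hI J hJ hne
    obtain ⟨p, hp, rfl⟩ := Finset.mem_image.mp (Finset.mem_coe.mp hI)
    obtain ⟨p', hp', rfl⟩ := Finset.mem_image.mp (Finset.mem_coe.mp hJ)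
    refine Set.eq_empty_of_forall_notMem fun q hq => hne ?_
    obtain ⟨⟨hq, h1, h2⟩, -, h3, h4⟩ := hq
    have e1 := (hiu ⟨q, hq⟩ _ (hTP p hp).1 h1).symm.trans (hiu ⟨q, hq⟩ _ (hTP p' hp').1 h3)
    have e2 := (hju ⟨q, hq⟩ _ (hTP p hp).2 h2).symm.trans (hju ⟨q, hq⟩ _ (hTP p' hp').2 h4)
    rw [Prod.ext e1 e2]
  · intro I hI
    obtain ⟨p, hp, rfl⟩ := Finset.mem_image.mp hI
    refine ⟨fun x hx z hz y hy => ?_⟩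
    have hy₀ : 0 ≤ y := hx.1.trans hy.1
    exact ⟨hy₀, (hPo _ (hTP p hp).1).out hx.2.1 hz.2.1 hy,
      (hQo _ (hTP p hp).2).out hx.2.2 hz.2.2 ⟨hg hx.1 hy₀ hy.1, hg hy₀ hz.1 hy.2⟩⟩
  · intro I hI
    obtain ⟨p, hp, rfl⟩ := Finset.mem_image.mp hI
    obtain ⟨c₁, d₁, h₁⟩ := hPa _ (hTP p hp).1
    obtain ⟨c₂, d₂, h₂⟩ := hQa _ (hTP p hp).2
    obtain ⟨c, d, h⟩ := hf c₁ d₁ c₂ d₂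
    exact ⟨c, d, fun q hq => h q hq.1 (h₁ q hq.2.1) (h₂ _ hq.2.2)⟩

end Breakpoints

/-- Series composition: the number of breakpoints of the
label function of `G' = G'[V₁] ∗ G'[V₂]` is at most the sum of the numbers of
breakpoints of the label functions of the two parts. -/
theorem statement17 [DecidableEq V] [Fintype V]
    (Aset Astar : Finset (V × V)) (s t r : V) (nu : V × V → ℝ)
    (hAstar : Astar ⊆ Aset) (hnu : ∀ a ∈ Aset, 0 < nu a)
    (htt : TwoTerminal Finset.univ Aset s t)
    (hreach : ∀ v : V, Relation.ReflTransGen (fun u w => (u, w) ∈ Aset) s v)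
    (V1 V2 : Finset V) (A1 A2 : Finset (V × V))
    (hA1 : A1 = Aset.filter (fun a => a.1 ∈ V1 ∧ a.2 ∈ V1))
    (hA2 : A2 = Aset.filter (fun a => a.1 ∈ V2 ∧ a.2 ∈ V2))
    (htt1 : TwoTerminal V1 A1 s r) (htt2 : TwoTerminal V2 A2 r t)
    (hVu : V1 ∪ V2 = Finset.univ) (hVi : V1 ∩ V2 = {r})
    (hAu : A1 ∪ A2 = Aset) (hAd : Disjoint A1 A2)
    (rhoG rho1 rho2 : ℝ → V → ℝ)
    (hrhoG : ∀ q : ℝ, 0 ≤ q → ∃ x : V × V → ℝ,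
      IsNTFOn Finset.univ Aset Astar nu s t x q (rhoG q) ∧ rhoG q s = 1)
    (hrho1 : ∀ q : ℝ, 0 ≤ q → ∃ x : V × V → ℝ,
      IsNTFOn V1 A1 (Astar ∩ A1) nu s r x q (rho1 q) ∧ rho1 q s = 1)
    (hrho2 : ∀ q : ℝ, 0 ≤ q → ∃ x : V × V → ℝ,
      IsNTFOn V2 A2 (Astar ∩ A2) nu r t x q (rho2 q) ∧ rho2 q r = 1)
    (hPLG : ∃ m : ℕ, AffinePieces (fun q (v : V) => rhoG q v) m)
    (hPL1 : ∃ m : ℕ, AffinePieces (fun q (v : {v // v ∈ V1}) => rho1 q v.val) m)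
    (hPL2 : ∃ m : ℕ, AffinePieces (fun q (v : {v // v ∈ V2}) => rho2 q v.val) m) :
    breakpoints (fun q (v : V) => rhoG q v) ≤
      breakpoints (fun q (v : {v // v ∈ V1}) => rho1 q v.val) +
      breakpoints (fun q (v : {v // v ∈ V2}) => rho2 q v.val) := by
  obtain ⟨x₁, hx₁, -⟩ := hrho1 1 zero_le_one
  have hsr : s ≠ r := source_ne_sink htt1 hx₁.1 one_ne_zero
  obtain ⟨x₂, hx₂, -⟩ := hrho2 1 zero_le_one
  have hrt : r ≠ t := source_ne_sink htt2 hx₂.1 one_ne_zero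
  have hA1s : A1 ⊆ Aset := hAu ▸ Finset.subset_union_left
  have hA2s : A2 ⊆ Aset := hAu ▸ Finset.subset_union_right
  have hnu1 : ∀ a ∈ A1, 0 < nu a := fun a ha => hnu a (hA1s ha)
  have hnu2 : ∀ a ∈ A2, 0 < nu a := fun a ha => hnu a (hA2s ha)
  have hinter : ∀ v, v ∈ V1 → v ∈ V2 → v = r := fun v h1 h2 => by
    simpa [hVi] using Finset.mem_inter.mpr ⟨h1, h2⟩
  have hV : ∀ v, v ∈ V1 ∨ v ∈ V2 := fun v => by
    simpa [hVu] using Finset.mem_union (s := V1) (t := V2) (a := v)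
  have hA : ∀ a ∈ Aset, a ∈ A1 ∨ a ∈ A2 := fun a ha => Finset.mem_union.mp (hAu ▸ ha)
  obtain ⟨hs1, hr1, hE1, -, -, hout1⟩ := id htt1
  obtain ⟨hr2, ht2, hE2, -, hin2, -⟩ := id htt2
  have hrout : ∀ a ∈ A1, a.1 ≠ r := (hout1 r hr1).mpr rfl
  have hrin : ∀ a ∈ A2, a.2 ≠ r := (hin2 r hr2).mpr rfl
  have hoe1 : ∀ a ∈ Aset, a.1 ∈ V1 → a.1 ≠ r → a ∈ A1 := fun a ha hv hvr =>
    (hA a ha).resolve_right fun h => hvr (hinter _ hv (hE2 a h).1)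
  have hie1 : ∀ a ∈ Aset, a.2 ∈ V1 → a ∈ A1 := fun a ha hv =>
    (hA a ha).resolve_right fun h => hrin a h (hinter _ hv (hE2 a h).2)
  have hoe2 : ∀ a ∈ Aset, a.1 ∈ V2 → a ∈ A2 := fun a ha hv =>
    (hA a ha).resolve_left fun h => hrout a h (hinter _ (hE1 a h).1 hv)
  have hie2 : ∀ a ∈ Aset, a.2 ∈ V2 → a.2 ≠ r → a ∈ A2 := fun a ha hv hvr =>
    (hA a ha).resolve_left fun h => hvr (hinter _ (hE1 a h).2 hv)
  have hfilter : ∀ {A' : Finset (V × V)} (p : V × V → Prop) [DecidablePred p], A' ⊆ Aset →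
      (∀ a ∈ Aset, p a → a ∈ A') → Aset.filter p = A'.filter p := by
    intro A' p _ hs h
    ext a
    simp only [Finset.mem_filter]
    exact ⟨fun ha => ⟨h a ha.1 ha.2, ha.2⟩, fun ha => ⟨hs ha.1, ha.2⟩⟩
  have key : ∀ q, 0 ≤ q → (∀ v ∈ V1, rhoG q v = rho1 q v) ∧
      ∀ v ∈ V2, rhoG q v = rho1 q r * rho2 (q / rho1 q r) v := by
    intro q hq
    obtain ⟨x, hx, hxs⟩ := hrhoG q hq
    obtain ⟨y, hy, hys⟩ := hrho1 q hq
    have hR1 : IsNTFOn V1 A1 (Astar ∩ A1) nu s r x q (rhoG q) := by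
      refine hx.restrict (Finset.subset_univ _) hA1s (fun a ha hv _ => hie1 a ha hv) hoe1
        (fun _ _ h => h) ?_ ?_
      · rintro v hv hvr rfl
        exact hvr (hinter _ hv ht2)
      · have := hx.1.2.2
        rw [outSum, inSum, hfilter (fun a => a.1 = s) hA1s (fun a ha h => hoe1 a ha (h ▸ hs1) (h ▸ hsr)),
          hfilter (fun a => a.2 = s) hA1s (fun a ha h => hie1 a ha (h ▸ hs1))] at this
        exact this
    have h1 : ∀ v ∈ V1, rhoG q v = rho1 q v := fun v hv => le_antisymm
      (hy.label_le hnu1 htt1 hsr hR1 le_rfl (by rw [hxs, hys]) v hv)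
      (hR1.label_le hnu1 htt1 hsr hy le_rfl (by rw [hxs, hys]) v hv)
    refine ⟨h1, ?_⟩
    have hR2 : IsNTFOn V2 A2 (Astar ∩ A2) nu r t x q (rhoG q) := by
      refine hx.restrict (Finset.subset_univ _) hA2s hie2 (fun a ha hv _ => hoe2 a ha hv)
        ?_ (fun _ _ h => h) ?_
      · rintro v hv hvr rfl
        exact hvr (hinter _ hs1 hv)
      · have hc := hx.1.2.1 r (Finset.mem_univ _) hsr.symm hrt
        have hsink := inSum_sub_outSum_sink htt1 hsr hR1.1
        rw [outSum, inSum, hfilter (fun a => a.1 = r) hA2s (fun a ha h => hoe2 a ha (h ▸ hr2)),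
          hfilter (fun a => a.2 = r) hA1s (fun a ha h => hie1 a ha (h ▸ hr1))] at hc
        rw [inSum, outSum, Finset.filter_false_of_mem hrout, Finset.sum_empty, sub_zero] at hsink
        rw [outSum, inSum, Finset.filter_false_of_mem hrin, Finset.sum_empty, sub_zero, hc, hsink]
    have hlam : 0 ≤ rho1 q r := hy.2.1 r hr1
    obtain ⟨z, hz, hzr⟩ := hrho2 (q / rho1 q r) (div_nonneg hq hlam)
    have hz' := hz.smul hlam
    have hval : rho1 q r * (q / rho1 q r) = q := by
      rcases hq.eq_or_lt with rfl | hq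
      · simp
      · exact mul_div_cancel₀ q (hy.label_sink_pos hnu1 htt1 hq).ne'
    have hlr : rhoG q r = rho1 q r * rho2 (q / rho1 q r) r := by
      rw [hzr, mul_one, h1 r hr1]
    exact fun v hv => le_antisymm
      (hz'.label_le hnu2 htt2 hrt hR2 hval.ge hlr.le v hv)
      (hR2.label_le hnu2 htt2 hrt hz' hval.le hlr.ge v hv)
  have hlam_nonneg : ∀ q, 0 ≤ q → 0 ≤ rho1 q r := fun q hq => by
    obtain ⟨y, hy, -⟩ := hrho1 q hq
    exact hy.2.1 r hr1
  have hlam_pos : ∀ q, 0 < q → 0 < rho1 q r := fun q hq => by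
    obtain ⟨y, hy, -⟩ := hrho1 q hq.le
    exact hy.label_sink_pos hnu1 htt1 hq
  refine breakpoints_le_add (fun q => q / rho1 q r) hPL1 hPL2
    (fun q hq => div_nonneg hq (hlam_nonneg q hq)) ?_ ?_
  · intro q (hq : 0 ≤ q) q' (hq' : 0 ≤ q') hqq
    rcases hq.eq_or_lt with rfl | hq₀
    · simpa using div_nonneg hq' (hlam_nonneg q' hq')
    · have hq₀' := hq₀.trans_le hqq
      obtain ⟨y, hy, hys⟩ := hrho1 q hq
      obtain ⟨y', hy', hys'⟩ := hrho1 q' hq'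
      have h := hy.label_le hnu1 htt1 hsr (hy'.smul (div_nonneg hq hq'))
        (div_mul_cancel₀ q hq₀'.ne').le
        (by rw [hys, hys', mul_one]; exact div_le_one_of_le₀ hqq hq') r hr1
      change q / rho1 q r ≤ q' / rho1 q' r
      rw [div_le_div_iff₀ (hlam_pos q hq₀) (hlam_pos q' hq₀')]
      rw [div_mul_eq_mul_div, div_le_iff₀ hq₀'] at h
      linarith
  · intro c₁ d₁ c₂ d₂
    refine ⟨fun v => if h : v ∈ V1 then c₁ ⟨v, h⟩ else
        if h' : v ∈ V2 then c₂ ⟨v, h'⟩ + d₂ ⟨v, h'⟩ * c₁ ⟨r, hr1⟩ else 0,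
      fun v => if h : v ∈ V1 then d₁ ⟨v, h⟩ else
        if h' : v ∈ V2 then d₂ ⟨v, h'⟩ * d₁ ⟨r, hr1⟩ else 0, fun q hq h1 h2 => ?_⟩
    funext v
    by_cases hv : v ∈ V1
    · have := congrFun h1 ⟨v, hv⟩
      simpa [hv, (key q hq).1 v hv] using this
    · have hv2 := (hV v).resolve_left hv
      have e1 := congrFun h1 ⟨r, hr1⟩
      have e2 := congrFun h2 ⟨v, hv2⟩
      simp only [Pi.add_apply, Pi.smul_apply, smul_eq_mul] at e1 e2
      simp only [Pi.add_apply, Pi.smul_apply, smul_eq_mul, hv, hv2, dite_true, dite_false]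
      rw [(key q hq).2 v hv2, e2]
      have hval : rho1 q r * (q / rho1 q r) = q := by
        rcases hq.eq_or_lt with rfl | hq
        · simp
        · exact mul_div_cancel₀ q (hlam_pos q hq).ne'
      linear_combination c₂ ⟨v, hv2⟩ * hval + d₂ ⟨v, hv2⟩ * e1
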